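/- For every constant C ∈ ℕ there exists c > 0 such that the following holds. Let m ≥ 1 and let S₀,…,S_m be disjoint subsets of ℤ² with #S_j ≤ 2^j. Let j⃗ = (j₁,j₂,j₃,j₄) ∈ {0,…,m}⁴ and a⃗ = (a₁,a₂,a₃,a₄) ∈ ℕ⁴ with 1 ≤ a₁ < j₁/2 + C. Then Σ_{(ξ₁,ξ₂,ξ₃,ξ₄) ∈ 𝒬⁰(j⃗,a⃗)} 1/gcd(ξ₁ − ξ₄) ≤ c · 2^{2j₁ − 2a₁ + a₂ + a₄/2}. -/

import Mathlib

open scoped BigOperators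

noncomputable section

/-- Points of the integer lattice `ℤ²`. -/
abbrev Pt := ℤ × ℤ

/-- A quadruple of lattice points, viewed as a function on `Fin 4`
(indices taken cyclically). -/
abbrev Quad := Fin 4 → Pt

/-- The embedding `ℤ² ↪ ℝ²`. -/
def emb (ξ : Pt) : ℝ × ℝ := ((ξ.1 : ℝ), (ξ.2 : ℝ))

/-- An affine line in the plane `ℝ²`. -/
def IsLine (ℓ : Set (ℝ × ℝ)) : Prop :=
  ∃ p v : ℝ × ℝ, v ≠ 0 ∧ ℓ = {x | ∃ t : ℝ, x = p + t • v}

/-- The line through two lattice points `p ≠ q` (a degenerate point if `p = q`). -/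
def lineThrough (p q : Pt) : Set (ℝ × ℝ) :=
  {x | ∃ t : ℝ, x = emb p + t • (emb q - emb p)}

/-- The number of points of a finite set `T ⊂ ℤ²` on a set `ℓ ⊂ ℝ²`,
i.e. `#(ℓ ∩ T)`. -/
def lineCount (ℓ : Set (ℝ × ℝ)) (T : Finset Pt) : ℕ :=
  (ℓ ∩ (emb '' (T : Set Pt))).ncard

/-- `Q = (ξ₁,ξ₂,ξ₃,ξ₄)` is a parallelogram: `ξ₁ + ξ₃ = ξ₂ + ξ₄`. -/
def IsPara (Q : Quad) : Prop := Q 0 + Q 2 = Q 1 + Q 3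

/-- The dot product `(ξ₁ − ξ₂)·(ξ₁ − ξ₄)`. -/
def dotQ (Q : Quad) : ℤ :=
  ((Q 0).1 - (Q 1).1) * ((Q 0).1 - (Q 3).1) + ((Q 0).2 - (Q 1).2) * ((Q 0).2 - (Q 3).2)

/-- `τ_Q = ||ξ₁|² − |ξ₂|² + |ξ₃|² − |ξ₄|²| = 2|(ξ₁−ξ₂)·(ξ₁−ξ₄)|`. -/
def tauQ (Q : Quad) : ℤ := 2 * |dotQ Q|

/-- `Q` is a rectangle: a parallelogram with `τ_Q = 0`. Membership in `𝒬⁰`. -/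
def IsRect (Q : Quad) : Prop := IsPara Q ∧ dotQ Q = 0

/-- `f(Q) = f(ξ₁)f(ξ₂)f(ξ₃)f(ξ₄)`. -/
def fQ (f : Pt → ℝ) (Q : Quad) : ℝ := ∏ k : Fin 4, f (Q k)

/-- The weight `f = ∑_{j=0}^m λ_j 2^{−j/2} χ_{S_j}`. -/
def fWt (S : ℕ → Finset Pt) (lam : ℕ → ℝ) (m : ℕ) (ξ : Pt) : ℝ :=
  ∑ j ∈ Finset.range (m + 1), if ξ ∈ S j then lam j * (2 : ℝ) ^ (-(j : ℝ) / 2) else 0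

/-- `gcd((a,b)) = gcd(|a|,|b|)` for `(a,b) ∈ ℤ²`. -/
def gcdP (ξ : Pt) : ℕ := Int.gcd ξ.1 ξ.2

/-- `max{#(ℓ(ξ,η₁) ∩ S_j), #(ℓ(ξ,η₂) ∩ S_j)}`, where `η₁, η₂` are the two
neighboring vertices of `ξ` in a rectangle. -/
def crossMax (S : ℕ → Finset Pt) (j : ℕ) (ξ η₁ η₂ : Pt) : ℕ :=
  max (lineCount (lineThrough ξ η₁) (S j)) (lineCount (lineThrough ξ η₂) (S j))

/-- `ξ` lies in some `S_j`, `j ≤ m`, and is a vertex of type `α ∈ {1,2,3}`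
relative to its neighbors `η₁, η₂`: with `a := log₂ crossMax`, type 1 means
`a ≥ j/2 + C` (i.e. `crossMax ≥ 2^{j/2+C}`), type 2 means `1 ≤ a < j/2 + C`
(i.e. `2 ≤ crossMax < 2^{j/2+C}`), and type 3 means `a = 0` (`crossMax = 1`). -/
def VertexType (S : ℕ → Finset Pt) (C m : ℕ) (α : ℕ) (ξ η₁ η₂ : Pt) : Prop :=
  ∃ j ≤ m, ξ ∈ S j ∧
    ((α = 1 ∧ (2 : ℝ) ^ ((j : ℝ) / 2 + (C : ℝ)) ≤ (crossMax S j ξ η₁ η₂ : ℝ)) ∨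
     (α = 2 ∧ 2 ≤ crossMax S j ξ η₁ η₂ ∧
        (crossMax S j ξ η₁ η₂ : ℝ) < (2 : ℝ) ^ ((j : ℝ) / 2 + (C : ℝ))) ∨
     (α = 3 ∧ crossMax S j ξ η₁ η₂ = 1))

/-- The set `𝒬⁰_{α,β}`: rectangles with four distinct vertices, all in
`∪_{j=0}^m S_j`, with `ξ₁, ξ₂` of type `α` and `ξ₃, ξ₄` of type `β`. -/
def QZeroAB (S : ℕ → Finset Pt) (C m : ℕ) (α β : ℕ) : Set Quad :=
  {Q | IsRect Q ∧ Function.Injective Q ∧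
    VertexType S C m α (Q 0) (Q 1) (Q 3) ∧
    VertexType S C m α (Q 1) (Q 2) (Q 0) ∧
    VertexType S C m β (Q 2) (Q 3) (Q 1) ∧
    VertexType S C m β (Q 3) (Q 0) (Q 2)}

/-- The set `𝒬⁰(j⃗, a⃗)`: rectangles with distinct vertices `ξ_k ∈ S_{j_k}` such
that for each `k` (cyclically), `2^{a_k} ≤ max{#(ℓ(ξ_k,ξ_{k+1}) ∩ S_{j_k}),
#(ℓ(ξ_k,ξ_{k−1}) ∩ S_{j_k})} < 2^{a_k+1}`. -/
def QZeroJA (S : ℕ → Finset Pt) (j a : Fin 4 → ℕ) : Set Quad :=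
  {Q | IsRect Q ∧ Function.Injective Q ∧ (∀ k, Q k ∈ S (j k)) ∧
    ∀ k : Fin 4,
      2 ^ (a k) ≤ max (lineCount (lineThrough (Q k) (Q (k + 1))) (S (j k)))
          (lineCount (lineThrough (Q k) (Q (k - 1))) (S (j k))) ∧
        max (lineCount (lineThrough (Q k) (Q (k + 1))) (S (j k)))
          (lineCount (lineThrough (Q k) (Q (k - 1))) (S (j k))) < 2 ^ (a k + 1)}


/-- Two affine functions whose order is reversed between `x` and `y` agree somewhere strictly
between `x` and `y`. -/
lemma exists_affine_eq {s b s' b' x y : ℝ} (hxy : x < y) (hx : s' * x + b' < s * x + b)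
    (hy : s * y + b < s' * y + b') :
    ∃ z, x < z ∧ z < y ∧ s * z + b = s' * z + b' := by
  have hs : 0 < s' - s := by
    by_contra! h
    nlinarith
  refine ⟨(b - b') / (s' - s), ?_, ?_, ?_⟩
  · rw [lt_div_iff₀ hs]; linarith
  · rw [div_lt_iff₀ hs]; linarith
  · field_simp
    ring

/-- A straight-line drawing without crossings has at most three times as many edges as vertices.
The edge `i` runs from `L i` to `R i` along the graph of `x ↦ s i * x + b i`. -/
theorem card_edges_le_of_noncrossing {α ι : Type*} (V : Finset α)
    (X Y : α → ℝ) (hX : Set.InjOn X V) (E : Finset ι) (L R : ι → α) (s b : ι → ℝ)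
    (hL : ∀ i ∈ E, L i ∈ V) (hR : ∀ i ∈ E, R i ∈ V)
    (hLR : ∀ i ∈ E, X (L i) < X (R i))
    (hYL : ∀ i ∈ E, Y (L i) = s i * X (L i) + b i)
    (hYR : ∀ i ∈ E, Y (R i) = s i * X (R i) + b i)
    (hcross : ∀ i ∈ E, ∀ j ∈ E, i ≠ j → ∀ x, X (L i) < x → x < X (R i) → X (L j) < x →
      x < X (R j) → s i * x + b i ≠ s j * x + b j) :
    E.card ≤ 3 * V.card := by
  classical
  rcases E.eq_empty_or_nonempty with rfl | ⟨i₀, -⟩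
  · simp
  have : Nonempty α := ⟨L i₀⟩
  have heq : ∀ i ∈ E, ∀ j ∈ E, L i = L j → s i = s j → i = j := by
    intro i hi j hj hl hs
    by_contra hne
    have h1 := hYL i hi
    have h2 := hYL j hj
    rw [hl, hs] at h1
    have hb : b i = b j := by linarith
    have h3 := hLR i hi
    have h4 := hLR j hj
    rw [hl] at h3
    obtain ⟨x, hx1, hx2⟩ := exists_between (lt_min h3 h4)
    rw [lt_min_iff] at hx2
    exact hcross i hi j hj hne x (hl ▸ hx1) hx2.1 hx1 hx2.2 (by rw [hs, hb])
  have hfan : ∀ i ∈ E, ∀ j ∈ E, L i = L j → s i < s j → ∀ x, X (L i) < x →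
      s i * x + b i < s j * x + b j := by
    intro i hi j hj hl hs x hx
    have h1 := hYL i hi
    have h2 := hYL j hj
    rw [← hl] at h2
    nlinarith
  set E₀ := E.filter fun i => ∃ j ∈ E, L j = L i ∧ s i < s j with hE₀
  have hsplit : E₀.card + (E.filter fun i => ¬ ∃ j ∈ E, L j = L i ∧ s i < s j).card = E.card :=
    Finset.card_filter_add_card_filter_not _
  have htop : (E.filter fun i => ¬ ∃ j ∈ E, L j = L i ∧ s i < s j).card ≤ V.card := by
    refine Finset.card_le_card_of_injOn L (fun i hi => ?_) (fun i hi j hj hl => ?_)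
    · simp only [Finset.coe_filter, Set.mem_ofPred_eq] at hi
      exact hL i hi.1
    · simp only [Finset.coe_filter, Set.mem_ofPred_eq, not_exists, not_and, not_lt] at hi hj
      exact heq i hi.1 j hj.1 hl (le_antisymm (hj.2 i hi.1 hl) (hi.2 j hj.1 hl.symm))
  -- Every edge with a successor `j` at its left endpoint is charged to the leftmost vertex `p`
  -- of the wedge that it bounds together with `j`.
  have hwedge : ∀ i ∈ E₀, ∃ j ∈ E, ∃ p ∈ V, L j = L i ∧ s i < s j ∧
      (∀ k ∈ E, L k = L i → s i < s k → s j ≤ s k) ∧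
      X (L i) < X p ∧ X p ≤ X (R i) ∧ X p ≤ X (R j) ∧
      s i * X p + b i ≤ Y p ∧ Y p ≤ s j * X p + b j ∧
      ∀ t ∈ V, X (L i) < X t → X t < X p →
        Y t < s i * X t + b i ∨ s j * X t + b j < Y t := by
    intro i hi
    rw [hE₀, Finset.mem_filter] at hi
    obtain ⟨hiE, j₀, hj₀, hl₀, hs₀⟩ := hi
    obtain ⟨j, hj, hjmin⟩ := Finset.exists_min_image
      (E.filter fun k => L k = L i ∧ s i < s k) s ⟨j₀, by simp [*]⟩
    simp only [Finset.mem_filter, and_imp] at hj hjmin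
    obtain ⟨hjE, hlj, hsj⟩ := hj
    have hfanij := hfan i hiE j hjE hlj.symm hsj
    obtain ⟨p, hp, hpmin⟩ := Finset.exists_min_image
      (V.filter fun t => X (L i) < X t ∧ X t ≤ X (R i) ∧ X t ≤ X (R j) ∧
        s i * X t + b i ≤ Y t ∧ Y t ≤ s j * X t + b j) X (by
          rcases le_total (X (R i)) (X (R j)) with h | h
          · have h1 := hLR i hiE
            have h2 := hYR i hiE
            have h3 := hfanij _ h1
            exact ⟨R i, Finset.mem_filter.2
              ⟨hR i hiE, h1, le_rfl, h, by linarith, by linarith⟩⟩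
          · have h1 := hLR j hjE
            rw [hlj] at h1
            have h2 := hYR j hjE
            have h3 := hfanij _ h1
            exact ⟨R j, Finset.mem_filter.2
              ⟨hR j hjE, h1, h, le_rfl, by linarith, by linarith⟩⟩)
    simp only [Finset.mem_filter, and_imp] at hp hpmin
    obtain ⟨hpV, hp1, hp2, hp3, hp4, hp5⟩ := hp
    refine ⟨j, hjE, p, hpV, hlj, hsj, fun k hk => hjmin k hk, hp1, hp2, hp3, hp4, hp5, ?_⟩
    intro t ht ht1 ht2
    by_contra! hcon
    exact absurd (hpmin t ht ht1 (ht2.le.trans hp2) (ht2.le.trans hp3) hcon.1 hcon.2)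
      (not_le.2 ht2)
  choose! J hJ p hp hJL hJs hJmin hp1 hp2 hp3 hp4 hp5 hpmin using hwedge
  have hsub : ∀ i ∈ E₀, i ∈ E := fun i hi => (Finset.mem_filter.1 hi).1
  have hlt : ∀ i ∈ E₀, s i * X (p i) + b i < s (J i) * X (p i) + b (J i) := fun i hi =>
    hfan i (hsub i hi) (J i) (hJ i hi) (hJL i hi).symm (hJs i hi) _ (hp1 i hi)
  have key : ∀ i ∈ E₀, ∀ i' ∈ E₀, p i = p i' →
      (Y (p i) < s (J i) * X (p i) + b (J i) ↔
        Y (p i') < s (J i') * X (p i') + b (J i')) →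
      ¬ X (L i) < X (L i') := by
    intro i hi i' hi' hpp htype hX'
    have g1 := hp1 i' hi'
    have g2 := hp2 i' hi'
    have g3 := hp3 i' hi'
    have g4 := hp4 i' hi'
    have g5 := hp5 i' hi'
    have glt := hlt i' hi'
    rw [← hpp] at g1 g2 g3 g4 g5 glt htype
    have f4 := hp4 i hi
    have f5 := hp5 i hi
    have flt := hlt i hi
    rcases hpmin i hi (L i') (hL i' (hsub i' hi')) hX' g1 with h | h
    · have h1 := hYL (J i') (hJ i' hi')
      rw [hJL i' hi'] at h1
      obtain ⟨z, hz1, hz2, hz⟩ := exists_affine_eq (s := s i) (b := b i) (s' := s (J i'))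
        (b' := b (J i')) g1 (by linarith) (by
          by_cases hc : Y (p i) < s (J i) * X (p i) + b (J i)
          · have := htype.1 hc; linarith
          · linarith)
      refine hcross i (hsub i hi) (J i') (hJ i' hi') ?_ z (hX'.trans hz1)
        (hz2.trans_le (hp2 i hi)) (by rwa [hJL i' hi']) (hz2.trans_le g3) hz
      intro h
      rw [h, hJL i' hi'] at hX'
      exact lt_irrefl _ hX'
    · have h1 := hYL i' (hsub i' hi')
      obtain ⟨z, hz1, hz2, hz⟩ := exists_affine_eq (s := s i') (b := b i') (s' := s (J i))
        (b' := b (J i)) g1 (by linarith) (by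
          by_cases hc : Y (p i) < s (J i) * X (p i) + b (J i)
          · linarith
          · have := not_lt.1 (mt htype.2 hc)
            linarith)
      refine hcross i' (hsub i' hi') (J i) (hJ i hi) ?_ z hz1 (hz2.trans_le g2)
        (by rw [hJL i hi]; exact hX'.trans hz1) (hz2.trans_le (hp3 i hi)) hz
      intro h
      rw [h, hJL i hi] at hX'
      exact lt_irrefl _ hX'
  have key' : ∀ i ∈ E₀, ∀ i' ∈ E₀, p i = p i' →
      (Y (p i) < s (J i) * X (p i) + b (J i) ↔
        Y (p i') < s (J i') * X (p i') + b (J i')) →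
      L i = L i' → ¬ s i < s i' := by
    intro i hi i' hi' hpp htype hl hs
    have h1 := hJmin i hi i' (hsub i' hi') hl.symm hs
    have g4 := hp4 i' hi'
    have g5 := hp5 i' hi'
    have glt := hlt i' hi'
    rw [← hpp] at g4 g5 glt htype
    have f5 := hp5 i hi
    have h2 : s (J i) * X (p i) + b (J i) ≤ s i' * X (p i) + b i' := by
      rcases h1.lt_or_eq with h1 | h1
      · exact (hfan (J i) (hJ i hi) i' (hsub i' hi') ((hJL i hi).trans hl) h1 _
          (by rw [hJL i hi]; exact hp1 i hi)).le
      · rw [heq (J i) (hJ i hi) i' (hsub i' hi') ((hJL i hi).trans hl) h1]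
    by_cases hc : Y (p i) < s (J i) * X (p i) + b (J i)
    · linarith
    · have := not_lt.1 (mt htype.2 hc)
      linarith
  have hcharge : E₀.card ≤ (V ×ˢ (Finset.univ : Finset Bool)).card := by
    refine Finset.card_le_card_of_injOn
      (fun i => (p i, decide (Y (p i) < s (J i) * X (p i) + b (J i)))) (fun i hi => ?_)
      (fun i hi j hj hij => ?_)
    · exact Finset.mem_coe.2 (Finset.mem_product.2 ⟨hp i hi, Finset.mem_univ _⟩)
    · rw [Finset.mem_coe] at hi hj
      simp only [Prod.mk.injEq, decide_eq_decide] at hij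
      obtain ⟨hpp, htype⟩ := hij
      have hl : L i = L j := by
        refine hX (hL i (hsub i hi)) (hL j (hsub j hj)) (le_antisymm ?_ ?_)
        · exact not_lt.1 (key j hj i hi hpp.symm htype.symm)
        · exact not_lt.1 (key i hi j hj hpp htype)
      refine heq i (hsub i hi) j (hsub j hj) hl (le_antisymm ?_ ?_)
      · exact not_lt.1 (key' j hj i hi hpp.symm htype.symm hl.symm)
      · exact not_lt.1 (key' i hi j hj hpp htype hl)
  rw [Finset.card_product, Finset.card_univ, Fintype.card_bool] at hcharge
  omega

/-- Among the colourings of `α` with `q` colours, a proportion `q ^ (-t)` paints a given `t`-element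
set with the colour `z`; summed over a family of such sets. -/
lemma sum_card_filter_colouring {α β : Type*} [Fintype α] [DecidableEq α] {q : ℕ} (z : Fin q)
    (F : Finset β) (T : β → Finset α) (t : ℕ) (hT : ∀ f ∈ F, (T f).card = t) :
    (∑ c : α → Fin q, (F.filter fun f => ∀ v ∈ T f, c v = z).card) * q ^ t =
      F.card * q ^ Fintype.card α := by
  classical
  have hcol : ∀ A : Finset α, (Finset.univ.filter fun c : α → Fin q => ∀ v ∈ A, c v = z).card *
      q ^ A.card = q ^ Fintype.card α := by
    intro A
    have h1 : (Finset.univ.filter fun c : α → Fin q => ∀ v ∈ A, c v = z) =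
        Fintype.piFinset fun v => if v ∈ A then {z} else Finset.univ := by
      ext c
      simp only [Finset.mem_filter, Finset.mem_univ, true_and, Fintype.mem_piFinset]
      refine forall_congr' fun v => ?_
      by_cases hv : v ∈ A <;> simp [hv]
    have h2 : ∀ v, (if v ∈ A then ({z} : Finset (Fin q)) else Finset.univ).card =
        if v ∈ A then 1 else q := by
      intro v
      by_cases hv : v ∈ A <;> simp [hv]
    have h3 : q ^ A.card = ∏ v : α, if v ∈ A then q else 1 := by
      rw [Finset.prod_ite_mem, Finset.univ_inter, Finset.prod_const]
    have h4 : ∀ v, ((if v ∈ A then 1 else q) * if v ∈ A then q else 1) = q := by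
      intro v
      by_cases hv : v ∈ A <;> simp [hv]
    rw [h1, Fintype.card_piFinset, Finset.prod_congr rfl fun v _ => h2 v, h3,
      ← Finset.prod_mul_distrib, Finset.prod_congr rfl fun v _ => h4 v, Finset.prod_const,
      Finset.card_univ]
  have hswap : (∑ c : α → Fin q, (F.filter fun f => ∀ v ∈ T f, c v = z).card) =
      ∑ f ∈ F, (Finset.univ.filter fun c : α → Fin q => ∀ v ∈ T f, c v = z).card := by
    simp only [Finset.card_filter]
    exact Finset.sum_comm
  rw [hswap, Finset.sum_mul, Finset.sum_congr rfl fun f hf => by rw [← hT f hf, hcol],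
    Finset.sum_const, smul_eq_mul]

/-- The crossing number inequality for straight-line drawings, in its sampled form: `Cr` contains
all (ordered) pairs of crossing edges, and `q` is the inverse sampling probability. -/
theorem card_edges_mul_sq_le {α ι : Type*} [Fintype α] [DecidableEq α]
    (X Y : α → ℝ) (hX : Function.Injective X) (E : Finset ι) (L R : ι → α) (s b : ι → ℝ)
    (hLR : ∀ i ∈ E, X (L i) < X (R i))
    (hYL : ∀ i ∈ E, Y (L i) = s i * X (L i) + b i)
    (hYR : ∀ i ∈ E, Y (R i) = s i * X (R i) + b i)
    (Cr : Finset (ι × ι))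
    (hCr : ∀ i ∈ E, ∀ j ∈ E, i ≠ j → ∀ x, X (L i) < x → x < X (R i) → X (L j) < x →
      x < X (R j) → s i * x + b i = s j * x + b j → (i, j) ∈ Cr)
    (hCr4 : ∀ e ∈ Cr, ({L e.1, R e.1, L e.2, R e.2} : Finset α).card = 4)
    {q : ℕ} (hq : 0 < q) :
    E.card * q ^ 2 ≤ 3 * Fintype.card α * q ^ 3 + Cr.card := by
  classical
  let z : Fin q := ⟨0, hq⟩
  have hV := sum_card_filter_colouring z (Finset.univ : Finset α) (fun v => {v}) 1 (by simp)
  have hE := sum_card_filter_colouring z E (fun i => {L i, R i}) 2 (fun i hi =>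
    Finset.card_pair fun h => (hLR i hi).ne (congrArg X h))
  have hC := sum_card_filter_colouring z Cr (fun e => {L e.1, R e.1, L e.2, R e.2}) 4 hCr4
  have hsample : ∀ c : α → Fin q,
      (E.filter fun i => ∀ v ∈ ({L i, R i} : Finset α), c v = z).card ≤
      3 * (Finset.univ.filter fun w : α => ∀ v ∈ ({w} : Finset α), c v = z).card +
      (Cr.filter fun e => ∀ v ∈ ({L e.1, R e.1, L e.2, R e.2} : Finset α), c v = z).card := by
    intro c
    set E' := E.filter fun i => ∀ v ∈ ({L i, R i} : Finset α), c v = z with hE'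
    set C' := Cr.filter fun e => ∀ v ∈ ({L e.1, R e.1, L e.2, R e.2} : Finset α), c v = z with hC'
    have hmem : ∀ i ∈ E', i ∈ E ∧ c (L i) = z ∧ c (R i) = z := by
      intro i hi
      simpa [hE'] using hi
    have h1 : (E' \ C'.image Prod.fst).card ≤
        3 * (Finset.univ.filter fun w : α => ∀ v ∈ ({w} : Finset α), c v = z).card := by
      have hsub : ∀ i ∈ E' \ C'.image Prod.fst, i ∈ E' := fun i hi => (Finset.mem_sdiff.1 hi).1
      refine card_edges_le_of_noncrossing _ X Y hX.injOn _ L R s b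
        (fun i hi => ?_) (fun i hi => ?_) (fun i hi => hLR i (hmem i (hsub i hi)).1)
        (fun i hi => hYL i (hmem i (hsub i hi)).1) (fun i hi => hYR i (hmem i (hsub i hi)).1) ?_
      · simpa using (hmem i (hsub i hi)).2.1
      · simpa using (hmem i (hsub i hi)).2.2
      · intro i hi j hj hij x hx1 hx2 hx3 hx4 hx
        obtain ⟨hiE, hi1, hi2⟩ := hmem i (hsub i hi)
        obtain ⟨hjE, hj1, hj2⟩ := hmem j (hsub j hj)
        refine (Finset.mem_sdiff.1 hi).2 (Finset.mem_image.2 ⟨(i, j), ?_, rfl⟩)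
        simp only [hC', Finset.mem_filter]
        refine ⟨hCr i hiE j hjE hij x hx1 hx2 hx3 hx4 hx, ?_⟩
        simp [hi1, hi2, hj1, hj2]
    have h2 : E'.card ≤ (E' \ C'.image Prod.fst).card + C'.card :=
      (Finset.card_le_card_sdiff_add_card (t := C'.image Prod.fst)).trans
        (Nat.add_le_add_left Finset.card_image_le _)
    omega
  have hsum := Finset.sum_le_sum fun c (_ : c ∈ (Finset.univ : Finset (α → Fin q))) => hsample c
  rw [Finset.sum_add_distrib, ← Finset.mul_sum] at hsum
  rw [Finset.card_univ] at hV
  have hpos : 0 < q ^ Fintype.card α := pow_pos hq _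
  refine Nat.le_of_mul_le_mul_right ?_ hpos
  have h4 := Nat.mul_le_mul_right (q ^ 4) hsum
  calc E.card * q ^ 2 * q ^ Fintype.card α = E.card * q ^ Fintype.card α * q ^ 2 := by ring
    _ = _ * q ^ 4 := by rw [← hE, mul_assoc, ← pow_add]
    _ ≤ _ := h4
    _ = 3 * (Fintype.card α * q ^ Fintype.card α) * q ^ 3 + Cr.card * q ^ Fintype.card α := by
      rw [← hV, ← hC]; ring
    _ = _ := by ring

/-- The choice of the sampling probability in the crossing number argument. -/
lemma mul_sq_le_of_forall_sampling {I e l k n : ℕ} (hn : 0 < n) (hIe : I ≤ 2 * e)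
    (hl : k * l ≤ I) (h : ∀ q : ℕ, 0 < q → e * q ^ 2 ≤ 3 * n * q ^ 3 + l ^ 2) :
    I * k ^ 2 ≤ 12 * n * k ^ 2 + 2304 * n ^ 2 := by
  rcases le_or_gt I (12 * n) with hI | hI
  · exact (Nat.mul_le_mul_right _ hI).trans (Nat.le_add_right _ _)
  have hn' : 0 < 12 * n := by positivity
  obtain ⟨q, hq, hq1, hq2⟩ : ∃ q : ℕ, 0 < q ∧ 12 * n * q ≤ I ∧ I ≤ 24 * n * q := by
    have h0 : 0 < I / (12 * n) := Nat.div_pos hI.le hn'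
    refine ⟨I / (12 * n), h0, Nat.mul_div_le _ _, ?_⟩
    have h1 := (Nat.lt_mul_div_succ I hn').le
    nlinarith
  have h1 : I * q ^ 2 ≤ 4 * l ^ 2 := by
    have h2 := h q hq
    have h3 := Nat.mul_le_mul_right (q ^ 2) hIe
    have h4 := Nat.mul_le_mul_right (q ^ 2) hq1
    nlinarith
  have h2 : q ^ 2 * k ^ 2 ≤ 4 * I := by
    have h3 := Nat.mul_le_mul_right (k ^ 2) h1
    have h4 := Nat.pow_le_pow_left hl 2
    have hI0 : 0 < I := by omega
    refine Nat.le_of_mul_le_mul_left ?_ hI0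
    nlinarith
  have h3 : I * k ^ 2 ≤ 2304 * n ^ 2 := by
    have h4 := Nat.mul_le_mul_right (k ^ 2) (Nat.pow_le_pow_left hq2 2)
    have h5 := Nat.mul_le_mul_left (576 * n ^ 2) h2
    have hI0 : 0 < I := by omega
    refine Nat.le_of_mul_le_mul_left ?_ hI0
    nlinarith
  omega

/-- The **Szemerédi–Trotter theorem** for rich lines: `n` points have
`O(n + n² / k²)` incidences with the lines that contain at least `k ≥ 2` of them. The line with
slope `l.1` and intercept `l.2` is represented by `l : ℝ × ℝ`. -/
theorem sum_card_rich_lines_mul_sq_le {α : Type*} [Fintype α] (X Y : α → ℝ)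
    (hX : Function.Injective X) (𝓛 : Finset (ℝ × ℝ)) {k : ℕ} (hk : 2 ≤ k)
    (hrich : ∀ l ∈ 𝓛, k ≤ (Finset.univ.filter fun p => Y p = l.1 * X p + l.2).card) :
    (∑ l ∈ 𝓛, (Finset.univ.filter fun p => Y p = l.1 * X p + l.2).card) * k ^ 2 ≤
      12 * Fintype.card α * k ^ 2 + 2304 * Fintype.card α ^ 2 := by
  classical
  rcases isEmpty_or_nonempty α with hα | hα
  · simp
  set T := (𝓛 ×ˢ (Finset.univ : Finset α)).filter
    fun e => Y e.2 = e.1.1 * X e.2 + e.1.2 with hT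
  set E := T.filter fun e => ∃ w, Y w = e.1.1 * X w + e.1.2 ∧ X e.2 < X w with hE
  have hmemT : ∀ e ∈ T, e.1 ∈ 𝓛 ∧ Y e.2 = e.1.1 * X e.2 + e.1.2 := by
    intro e he
    simpa [hT] using he
  have hmemE : ∀ e ∈ E, e ∈ T := fun e he => (Finset.mem_filter.1 he).1
  have hcardT : T.card = ∑ l ∈ 𝓛, (Finset.univ.filter fun p => Y p = l.1 * X p + l.2).card := by
    simp only [hT, Finset.card_filter, Finset.sum_product]
  have hnext : ∀ e ∈ E, ∃ w, Y w = e.1.1 * X w + e.1.2 ∧ X e.2 < X w ∧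
      ∀ v, Y v = e.1.1 * X v + e.1.2 → X e.2 < X v → X w ≤ X v := by
    intro e he
    obtain ⟨w, hw⟩ := (Finset.mem_filter.1 he).2
    obtain ⟨w, hw, hmin⟩ := Finset.exists_min_image
      (Finset.univ.filter fun w => Y w = e.1.1 * X w + e.1.2 ∧ X e.2 < X w) X ⟨w, by simpa using hw⟩
    simp only [Finset.mem_filter, Finset.mem_univ, true_and, and_imp] at hw hmin
    exact ⟨w, hw.1, hw.2, hmin⟩
  choose! R hR hLR hRmin using hnext
  have hsame : ∀ e ∈ E, ∀ f ∈ E, e.1 = f.1 → ∀ x, X e.2 < x → x < X (R e) → X f.2 < x →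
      x < X (R f) → e = f := by
    intro e he f hf hef x h1 h2 h3 h4
    have he' := (hmemT e (hmemE e he)).2
    have hf' := (hmemT f (hmemE f hf)).2
    refine Prod.ext hef (hX (le_antisymm ?_ ?_))
    · by_contra! hlt
      have := hRmin f hf e.2 (hef ▸ he') hlt
      linarith
    · by_contra! hlt
      have := hRmin e he f.2 (hef ▸ hf') hlt
      linarith
  have hmeet : ∀ l l' : ℝ × ℝ, l ≠ l' → ∀ x y, l.1 * x + l.2 = l'.1 * x + l'.2 →
      l.1 * y + l.2 = l'.1 * y + l'.2 → x = y := by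
    intro l l' hll x y hx hy
    by_contra hxy
    have h1 : (l.1 - l'.1) * (x - y) = 0 := by linarith
    have h2 : l.1 = l'.1 := by
      rcases mul_eq_zero.1 h1 with h | h
      · linarith
      · exact absurd (by linarith) hxy
    refine hll (Prod.ext h2 ?_)
    rw [h2] at hx
    linarith
  set Cr := (E ×ˢ E).filter fun c => c.1 ≠ c.2 ∧ ∃ x, X c.1.2 < x ∧ x < X (R c.1) ∧
    X c.2.2 < x ∧ x < X (R c.2) ∧ c.1.1.1 * x + c.1.1.2 = c.2.1.1 * x + c.2.1.2 with hCr
  have hmemCr : ∀ c ∈ Cr, c.1 ∈ E ∧ c.2 ∈ E ∧ c.1.1 ≠ c.2.1 ∧ ∃ x, X c.1.2 < x ∧ x < X (R c.1) ∧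
      X c.2.2 < x ∧ x < X (R c.2) ∧ c.1.1.1 * x + c.1.1.2 = c.2.1.1 * x + c.2.1.2 := by
    intro c hc
    simp only [hCr, Finset.mem_filter, Finset.mem_product] at hc
    obtain ⟨⟨h1, h2⟩, h3, x, hx1, hx2, hx3, hx4, hx5⟩ := hc
    exact ⟨h1, h2, fun h => h3 (hsame _ h1 _ h2 h x hx1 hx2 hx3 hx4), x, hx1, hx2, hx3, hx4, hx5⟩
  have hcardCr : Cr.card ≤ 𝓛.card ^ 2 := by
    rw [sq, ← Finset.card_product]
    refine Finset.card_le_card_of_injOn (fun c => (c.1.1, c.2.1)) (fun c hc => ?_)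
      (fun c hc d hd hcd => ?_)
    · obtain ⟨h1, h2, -⟩ := hmemCr c hc
      exact Finset.mem_coe.2 (Finset.mem_product.2
        ⟨(hmemT _ (hmemE _ h1)).1, (hmemT _ (hmemE _ h2)).1⟩)
    · obtain ⟨h1, h2, h3, x, hx1, hx2, hx3, hx4, hx5⟩ := hmemCr c hc
      obtain ⟨g1, g2, g3, y, hy1, hy2, hy3, hy4, hy5⟩ := hmemCr d hd
      obtain ⟨e1, e2⟩ := Prod.mk.inj hcd
      rw [← e1, ← e2] at hy5
      obtain rfl := hmeet _ _ h3 x y hx5 hy5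
      exact Prod.ext (hsame _ h1 _ g1 e1 x hx1 hx2 hy1 hy2)
        (hsame _ h2 _ g2 e2 x hx3 hx4 hy3 hy4)
  have hCr4 : ∀ c ∈ Cr, ({c.1.2, R c.1, c.2.2, R c.2} : Finset α).card = 4 := by
    intro c hc
    obtain ⟨h1, h2, h3, x, hx1, hx2, hx3, hx4, hx5⟩ := hmemCr c hc
    have hne : ∀ p p', Y p = c.1.1.1 * X p + c.1.1.2 → Y p' = c.2.1.1 * X p' + c.2.1.2 →
        X p ≠ x → p ≠ p' := by
      rintro p p' hp hp' hpx rfl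
      exact hpx (hmeet _ _ h3 _ _ (hp.symm.trans hp') hx5)
    have a1 := (hmemT _ (hmemE _ h1)).2
    have a2 := (hmemT _ (hmemE _ h2)).2
    have n1 : c.1.2 ≠ R c.1 := fun h => (hx1.trans hx2).ne (congrArg X h)
    have n2 : c.2.2 ≠ R c.2 := fun h => (hx3.trans hx4).ne (congrArg X h)
    have n3 := hne _ _ a1 a2 hx1.ne
    have n4 := hne _ _ a1 (hR _ h2) hx1.ne
    have n5 := hne _ _ (hR _ h1) a2 hx2.ne'
    have n6 := hne _ _ (hR _ h1) (hR _ h2) hx2.ne'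
    rw [Finset.card_insert_of_notMem (by simp [*]), Finset.card_insert_of_notMem (by simp [*]),
      Finset.card_pair n2]
  have hTE : T.card ≤ E.card + 𝓛.card := by
    have h1 : (T \ E).card ≤ 𝓛.card := by
      refine Finset.card_le_card_of_injOn Prod.fst (fun e he => ?_) (fun e he f hf hef => ?_)
      · exact (hmemT e (Finset.mem_sdiff.1 he).1).1
      · obtain ⟨he1, he2⟩ := Finset.mem_sdiff.1 he
        obtain ⟨hf1, hf2⟩ := Finset.mem_sdiff.1 hf
        have he' := (hmemT e he1).2
        have hf' := (hmemT f hf1).2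
        refine Prod.ext hef (hX (le_antisymm ?_ ?_))
        · by_contra! hlt
          exact hf2 (Finset.mem_filter.2 ⟨hf1, e.2, hef ▸ he', hlt⟩)
        · by_contra! hlt
          exact he2 (Finset.mem_filter.2 ⟨he1, f.2, hef ▸ hf', hlt⟩)
    have h2 := Finset.card_le_card_sdiff_add_card (s := T) (t := E)
    omega
  have hkT : k * 𝓛.card ≤ T.card := by
    rw [hcardT, mul_comm, ← smul_eq_mul]
    exact Finset.card_nsmul_le_sum _ _ _ hrich
  rw [← hcardT]
  refine mul_sq_le_of_forall_sampling Fintype.card_pos (e := E.card) (l := 𝓛.card) (by nlinarith)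
    hkT fun q hq => ?_
  refine (card_edges_mul_sq_le X Y hX E Prod.snd R (fun e => e.1.1) (fun e => e.1.2) hLR
    (fun e he => (hmemT e (hmemE e he)).2) hR Cr ?_ hCr4 hq).trans
      (Nat.add_le_add_left hcardCr _)
  intro i hi j hj hij x hx1 hx2 hx3 hx4 hx5
  exact Finset.mem_filter.2
    ⟨Finset.mem_product.2 ⟨hi, hj⟩, hij, x, hx1, hx2, hx3, hx4, hx5⟩

/-- A linear functional on `ℤ²` that separates all lattice points. -/
def skewCoord (p : Pt) : ℝ := p.1 + √2 * p.2

lemma skewCoord_injective : Function.Injective skewCoord := by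
  intro p q h
  simp only [skewCoord] at h
  have h2 : p.2 = q.2 := by
    by_contra hne
    refine (irrational_sqrt_two.mul_intCast (sub_ne_zero.2 hne)).ne_int (q.1 - p.1) ?_
    push_cast
    linarith
  rw [h2] at h
  refine Prod.ext ?_ h2
  exact_mod_cast add_right_cancel h

/-- The determinant of `q - p` and `x - p`, which vanishes iff `p`, `q`, `x` are collinear. -/
def collinDet (p q x : Pt) : ℤ := (q.1 - p.1) * (x.2 - p.2) - (q.2 - p.2) * (x.1 - p.1)

lemma emb_injective : Function.Injective emb := by
  intro p q h
  simp only [emb, Prod.mk.injEq, Int.cast_inj] at h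
  exact Prod.ext h.1 h.2

lemma emb_mem_lineThrough_iff {p q : Pt} (hpq : p ≠ q) (x : Pt) :
    emb x ∈ lineThrough p q ↔ collinDet p q x = 0 := by
  have hcast : collinDet p q x = 0 ↔
      ((q.1 : ℝ) - p.1) * (x.2 - p.2) - (q.2 - p.2) * (x.1 - p.1) = 0 := by
    rw [collinDet, ← Int.cast_inj (α := ℝ)]
    push_cast
    rfl
  rw [hcast]
  simp only [lineThrough, Set.mem_ofPred_eq, emb, Prod.ext_iff, Prod.fst_add, Prod.snd_add,
    Prod.smul_fst, Prod.smul_snd, Prod.fst_sub, Prod.snd_sub, smul_eq_mul]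
  constructor
  · rintro ⟨t, h1, h2⟩
    rw [h1, h2]
    ring
  · intro h
    by_cases h1 : q.1 = p.1
    · have h2 : (q.2 : ℝ) - p.2 ≠ 0 := by
        rw [sub_ne_zero]
        exact fun h2 => hpq (Prod.ext h1.symm (by exact_mod_cast h2.symm))
      refine ⟨(x.2 - p.2) / (q.2 - p.2), ?_, by field_simp; ring⟩
      have h3 : ((q.2 : ℝ) - p.2) * (x.1 - p.1) = 0 := by
        rw [h1] at h
        linarith
      have h4 := (mul_eq_zero.1 h3).resolve_left h2
      rw [h1]
      linarith
    · have h2 : (q.1 : ℝ) - p.1 ≠ 0 := by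
        rw [sub_ne_zero]
        exact_mod_cast h1
      refine ⟨(x.1 - p.1) / (q.1 - p.1), by field_simp; ring, ?_⟩
      field_simp
      linarith

lemma lineCount_lineThrough {p q : Pt} (hpq : p ≠ q) (T : Finset Pt) :
    lineCount (lineThrough p q) T = (T.filter fun x => collinDet p q x = 0).card := by
  have h : lineThrough p q ∩ emb '' (T : Set Pt) =
      emb '' ((T.filter fun x => collinDet p q x = 0 : Finset Pt) : Set Pt) := by
    ext y
    constructor
    · rintro ⟨hy, x, hx, rfl⟩
      exact ⟨x, by simpa using ⟨hx, (emb_mem_lineThrough_iff hpq x).1 hy⟩, rfl⟩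
    · rintro ⟨x, hx, rfl⟩
      rw [Finset.mem_coe, Finset.mem_filter] at hx
      exact ⟨(emb_mem_lineThrough_iff hpq x).2 hx.2, x, hx.1, rfl⟩
  rw [lineCount, h, Set.ncard_image_of_injective _ emb_injective, Set.ncard_coe_finset]

/-- Slope and intercept, with respect to `skewCoord` and the second coordinate, of the line through
two lattice points. -/
def slopeIntercept (p q : Pt) : ℝ × ℝ :=
  ((q.2 - p.2) / (skewCoord q - skewCoord p),
    p.2 - (q.2 - p.2) / (skewCoord q - skewCoord p) * skewCoord p)

lemma mem_slopeIntercept_iff {p q : Pt} (hpq : p ≠ q) (x : Pt) :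
    (x.2 : ℝ) = (slopeIntercept p q).1 * skewCoord x + (slopeIntercept p q).2 ↔
      collinDet p q x = 0 := by
  have h : skewCoord q - skewCoord p ≠ 0 :=
    sub_ne_zero.2 fun h => hpq (skewCoord_injective h.symm)
  have h1 : (x.2 : ℝ) = (slopeIntercept p q).1 * skewCoord x + (slopeIntercept p q).2 ↔
      ((x.2 : ℝ) - p.2) * (skewCoord q - skewCoord p) =
        (q.2 - p.2) * (skewCoord x - skewCoord p) := by
    simp only [slopeIntercept]
    rw [← eq_div_iff h, mul_div_right_comm]
    constructor <;> intro h' <;> linarith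
  rw [h1, collinDet, ← Int.cast_inj (α := ℝ)]
  push_cast
  simp only [skewCoord]
  constructor <;> intro h' <;> linarith

lemma collinDet_eq_zero_of_slopeIntercept_eq {p q q' : Pt} (hq : p ≠ q) (hq' : p ≠ q')
    (h : slopeIntercept p q = slopeIntercept p q') : collinDet p q q' = 0 := by
  rw [← mem_slopeIntercept_iff hq, h, mem_slopeIntercept_iff hq', collinDet]
  ring

lemma collinDet_swap (p q x : Pt) : collinDet q p x = -collinDet p q x := by
  simp only [collinDet]
  ring

/-- The Szemerédi–Trotter bound for a set `I` of incidences between points of `P` and lines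
containing at least `k` points of `P`. -/
lemma card_rich_incidences_mul_sq_le (P : Finset Pt) {k : ℕ} (hk : 2 ≤ k)
    (I : Finset ((ℝ × ℝ) × Pt))
    (hI : ∀ e ∈ I, e.2 ∈ P ∧ (e.2.2 : ℝ) = e.1.1 * skewCoord e.2 + e.1.2 ∧
      k ≤ (P.filter fun x => (x.2 : ℝ) = e.1.1 * skewCoord x + e.1.2).card) :
    I.card * k ^ 2 ≤ 12 * P.card * k ^ 2 + 2304 * P.card ^ 2 := by
  classical
  have hcard : ∀ l : ℝ × ℝ,
      (Finset.univ.filter fun x : P => ((x : Pt).2 : ℝ) = l.1 * skewCoord x + l.2).card =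
        (P.filter fun x => (x.2 : ℝ) = l.1 * skewCoord x + l.2).card := by
    intro l
    refine Finset.card_bij (fun x _ => (x : Pt)) (fun x hx => ?_)
      (fun x _ y _ h => Subtype.ext h) (fun x hx => ?_)
    · exact Finset.mem_filter.2 ⟨x.2, (Finset.mem_filter.1 hx).2⟩
    · obtain ⟨hx1, hx2⟩ := Finset.mem_filter.1 hx
      exact ⟨⟨x, hx1⟩, Finset.mem_filter.2 ⟨Finset.mem_univ _, hx2⟩, rfl⟩
  have hST := sum_card_rich_lines_mul_sq_le (fun x : P => skewCoord x)
    (fun x : P => ((x : Pt).2 : ℝ)) (fun x y h => Subtype.ext (skewCoord_injective h))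
    (I.image Prod.fst) hk (by
      intro l hl
      obtain ⟨e, he, rfl⟩ := Finset.mem_image.1 hl
      rw [hcard]
      exact (hI e he).2.2)
  rw [Fintype.card_coe] at hST
  refine (Nat.mul_le_mul_right _ ?_).trans hST
  rw [Finset.card_eq_sum_card_image Prod.fst I]
  refine Finset.sum_le_sum fun l _ => ?_
  rw [hcard]
  refine Finset.card_le_card_of_injOn Prod.snd (fun e he => ?_) (fun e he f hf hef => ?_)
  · obtain ⟨he1, rfl⟩ := Finset.mem_filter.1 he
    exact Finset.mem_coe.2 (Finset.mem_filter.2 ⟨(hI e he1).1, (hI e he1).2.1⟩)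
  · exact Prod.ext ((Finset.mem_filter.1 he).2.trans (Finset.mem_filter.1 hf).2.symm) hef

/-- Parallel lattice vectors with the same gcd agree up to sign. -/
lemma eq_or_eq_neg_of_gcd_eq {a b c d : ℤ} (hdet : a * d = b * c)
    (hg : Int.gcd a b = Int.gcd c d) : (a = c ∧ b = d) ∨ (a = -c ∧ b = -d) := by
  rcases Nat.eq_zero_or_pos (Int.gcd a b) with h0 | h0
  · obtain ⟨rfl, rfl⟩ := Int.gcd_eq_zero_iff.1 h0
    obtain ⟨rfl, rfl⟩ := Int.gcd_eq_zero_iff.1 (hg ▸ h0)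
    simp
  have h1 : a.natAbs = c.natAbs := by
    have h : Int.gcd (a * c) (a * d) = Int.gcd (c * a) (c * b) := by
      rw [hdet, mul_comm a c, mul_comm b c]
    rw [Int.gcd_mul_left, Int.gcd_mul_left, ← hg] at h
    exact Nat.eq_of_mul_eq_mul_right h0 h
  have h2 : b.natAbs = d.natAbs := by
    have h : Int.gcd (b * c) (b * d) = Int.gcd (d * a) (d * b) := by
      rw [← hdet, mul_comm a d, mul_comm b d]
    rw [Int.gcd_mul_left, Int.gcd_mul_left, ← hg] at h
    exact Nat.eq_of_mul_eq_mul_right h0 h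
  rcases Int.natAbs_eq_natAbs_iff.1 h1 with rfl | rfl <;>
    rcases Int.natAbs_eq_natAbs_iff.1 h2 with rfl | rfl
  · exact Or.inl ⟨rfl, rfl⟩
  · have : a * d = 0 := by linarith
    rcases mul_eq_zero.1 this with rfl | rfl <;> simp
  · have : c * b = 0 := by linarith
    rcases mul_eq_zero.1 this with rfl | rfl <;> simp
  · exact Or.inr ⟨rfl, rfl⟩

lemma gcdP_sub_pos {p q : Pt} (h : q ≠ p) : 0 < gcdP (p - q) := by
  rw [gcdP, Int.gcd_pos_iff]
  by_contra! hcon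
  exact h (sub_eq_zero.1 (Prod.ext hcon.1 hcon.2 : p - q = 0)).symm

/-- The reciprocals of the gcds of the vectors from `p` to the points of a subset `T` of a line
through `p` sum to at most `2 √#T`. -/
lemma sum_inv_gcdP_le (p : Pt) (T : Finset Pt) (hT : ∀ q ∈ T, q ≠ p)
    (hline : ∀ q ∈ T, ∀ q' ∈ T, collinDet p q q' = 0) :
    ∑ q ∈ T, 1 / (gcdP (p - q) : ℝ) ≤ 2 * √(T.card : ℝ) := by
  classical
  have hfib : ∀ g : ℕ, (T.filter fun q => gcdP (p - q) = g).card ≤ 2 := by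
    intro g
    rcases (T.filter fun q => gcdP (p - q) = g).eq_empty_or_nonempty with h | ⟨q, hq⟩
    · simp [h]
    · obtain ⟨hq1, hq2⟩ := Finset.mem_filter.1 hq
      refine (Finset.card_le_card (t := {q, p + p - q}) fun r hr => ?_).trans Finset.card_le_two
      obtain ⟨hr1, hr2⟩ := Finset.mem_filter.1 hr
      have hdet := hline q hq1 r hr1
      rw [collinDet] at hdet
      rw [Finset.mem_insert, Finset.mem_singleton]
      rcases eq_or_eq_neg_of_gcd_eq (a := (p - r).1) (b := (p - r).2) (c := (p - q).1)
        (d := (p - q).2) (by simp only [Prod.fst_sub, Prod.snd_sub]; linarith)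
        (hr2.trans hq2.symm) with ⟨h1, h2⟩ | ⟨h1, h2⟩
      · left
        simp only [Prod.fst_sub, Prod.snd_sub] at h1 h2
        exact Prod.ext (by omega) (by omega)
      · right
        simp only [Prod.fst_sub, Prod.snd_sub] at h1 h2
        exact Prod.ext (by simp only [Prod.fst_sub, Prod.fst_add]; omega)
          (by simp only [Prod.snd_sub, Prod.snd_add]; omega)
  have hsq : ∑ q ∈ T, (1 / (gcdP (p - q) : ℝ)) ^ 2 ≤ 4 := by
    set G := T.image fun q => gcdP (p - q) with hG
    have h1 : ∑ q ∈ T, (1 / (gcdP (p - q) : ℝ)) ^ 2 ≤ ∑ g ∈ G, 2 * ((g : ℝ) ^ 2)⁻¹ := by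
      rw [← Finset.sum_fiberwise_of_maps_to
        (fun q hq => Finset.mem_image_of_mem (fun q => gcdP (p - q)) hq)]
      refine Finset.sum_le_sum fun g _ => ?_
      rw [Finset.sum_congr rfl (g := fun _ => ((g : ℝ) ^ 2)⁻¹) (fun q hq => by
        rw [(Finset.mem_filter.1 hq).2, one_div, inv_pow]), Finset.sum_const, nsmul_eq_mul]
      refine mul_le_mul_of_nonneg_right ?_ (by positivity)
      exact_mod_cast hfib g
    have h2 : ∑ g ∈ G, ((g : ℝ) ^ 2)⁻¹ ≤ 2 := by
      have h3 := sum_Ioo_inv_sq_le (α := ℝ) 0 (G.sup id + 1)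
      rw [Nat.cast_zero, zero_add, div_one] at h3
      refine (Finset.sum_le_sum_of_subset_of_nonneg (fun g hg => ?_)
        (fun _ _ _ => by positivity)).trans h3
      rw [Finset.mem_Ioo]
      refine ⟨?_, Nat.lt_succ_of_le (Finset.le_sup (f := id) hg)⟩
      obtain ⟨q, hq, rfl⟩ := Finset.mem_image.1 hg
      exact gcdP_sub_pos (hT q hq)
    rw [← Finset.mul_sum] at h1
    linarith
  have hcs := sq_sum_le_card_mul_sum_sq (s := T) (f := fun q => 1 / (gcdP (p - q) : ℝ))
  refine le_trans (Real.le_sqrt_of_sq_le (hcs.trans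
    (mul_le_mul_of_nonneg_left hsq (Nat.cast_nonneg _)))) ?_
  rw [mul_comm, Real.sqrt_mul (by norm_num), show (4 : ℝ) = 2 ^ 2 by norm_num,
    Real.sqrt_sq (by norm_num)]

/-- If `u ∥ u'`, `u ⊥ v` and `u' ⊥ v'` with `u, u' ≠ 0` in the plane, then `v ∥ v'`. -/
lemma det_eq_zero_of_perp {a b c d a' b' c' d' : ℤ} (hu : a ≠ 0 ∨ b ≠ 0) (hu' : a' ≠ 0 ∨ b' ≠ 0)
    (hdot : a * c + b * d = 0) (hdot' : a' * c' + b' * d' = 0) (hdet : a * b' - b * a' = 0) :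
    c * d' - d * c' = 0 := by
  have h1 : a * a' * (c * d' - d * c') = 0 := by
    linear_combination a' * d' * hdot - a * d * hdot' + d * d' * hdet
  have h2 : b * b' * (c * d' - d * c') = 0 := by
    linear_combination b * c * hdot' - b' * c' * hdot + c * c' * hdet
  rcases mul_eq_zero.1 h1 with h | h
  · rcases mul_eq_zero.1 h2 with h' | h'
    · exfalso
      rcases mul_eq_zero.1 h with rfl | rfl <;> rcases mul_eq_zero.1 h' with rfl | rfl <;>
        simp_all
    · exact h'
  · exact h

lemma sub_fst_ne_zero_or_snd_ne_zero {p q : Pt} (h : p ≠ q) :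
    q.1 - p.1 ≠ 0 ∨ q.2 - p.2 ≠ 0 := by
  by_contra! hcon
  exact h (Prod.ext (by omega) (by omega))

/-- In two rectangles with a common vertex, one pair of sides at that vertex is parallel iff the
other one is. -/
lemma collinDet_one_eq_zero_iff_three {Q Q' : Quad} (hQ : IsRect Q) (hQ' : IsRect Q')
    (hinj : Function.Injective Q) (hinj' : Function.Injective Q') (h0 : Q 0 = Q' 0) :
    collinDet (Q 0) (Q 1) (Q' 1) = 0 ↔ collinDet (Q 0) (Q 3) (Q' 3) = 0 := by
  have hd := hQ.2
  have hd' := hQ'.2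
  rw [dotQ] at hd hd'
  rw [← h0] at hd'
  have hne : ∀ k : Fin 4, k ≠ 0 → Q 0 ≠ Q k := fun k hk h => hk (hinj h).symm
  have hne' : ∀ k : Fin 4, k ≠ 0 → Q 0 ≠ Q' k := fun k hk h => hk (hinj' (h0 ▸ h)).symm
  constructor
  · exact det_eq_zero_of_perp (sub_fst_ne_zero_or_snd_ne_zero (hne 1 (by decide)))
      (sub_fst_ne_zero_or_snd_ne_zero (hne' 1 (by decide))) (by linarith) (by linarith)
  · exact det_eq_zero_of_perp (sub_fst_ne_zero_or_snd_ne_zero (hne 3 (by decide)))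
      (sub_fst_ne_zero_or_snd_ne_zero (hne' 3 (by decide))) (by linarith) (by linarith)

/-- The contribution of the rectangles with prescribed first vertex and prescribed lines through
that vertex. -/
lemma sum_inv_gcdP_le_of_common_cross {S : ℕ → Finset Pt} {j a : Fin 4 → ℕ} (p : Pt)
    (G : Finset Quad) (hG : ∀ Q ∈ G, Q ∈ QZeroJA S j a) (hp : ∀ Q ∈ G, Q 0 = p)
    (h1 : ∀ Q ∈ G, ∀ Q' ∈ G, collinDet p (Q 1) (Q' 1) = 0)
    (h3 : ∀ Q ∈ G, ∀ Q' ∈ G, collinDet p (Q 3) (Q' 3) = 0) :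
    ∑ Q ∈ G, 1 / (gcdP (Q 0 - Q 3) : ℝ) ≤ 2 ^ (a 1 + 1) * (2 * √(2 ^ (a 3 + 1))) := by
  classical
  have hne : ∀ Q ∈ G, ∀ k : Fin 4, k ≠ 0 → Q k ≠ p := by
    intro Q hQ k hk h
    exact hk ((hG Q hQ).2.1 (h.trans (hp Q hQ).symm))
  have hcard : ∀ k : Fin 4, k ≠ 0 →
      (∀ Q ∈ QZeroJA S j a, lineCount (lineThrough (Q k) (Q 0)) (S (j k)) < 2 ^ (a k + 1)) →
      (∀ Q ∈ G, ∀ Q' ∈ G, collinDet p (Q k) (Q' k) = 0) →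
      (G.image fun Q => Q k).card ≤ 2 ^ (a k + 1) := by
    intro k hk hlt hcol
    rcases G.eq_empty_or_nonempty with rfl | ⟨Q₀, hQ₀⟩
    · simp
    have h := hlt Q₀ (hG Q₀ hQ₀)
    rw [hp Q₀ hQ₀, lineCount_lineThrough (hne Q₀ hQ₀ k hk)] at h
    refine (Finset.card_le_card fun x hx => ?_).trans h.le
    obtain ⟨Q, hQ, rfl⟩ := Finset.mem_image.1 hx
    rw [Finset.mem_filter, collinDet_swap, hcol Q₀ hQ₀ Q hQ, neg_zero]
    exact ⟨(hG Q hQ).2.2.1 k, rfl⟩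
  have hc1 := hcard 1 (by decide)
    (fun Q hQ => (le_max_right _ _).trans_lt (hQ.2.2.2 1).2) h1
  have hc3 := hcard 3 (by decide)
    (fun Q hQ => (le_max_left _ _).trans_lt (hQ.2.2.2 3).2) h3
  have hgcd := sum_inv_gcdP_le p (G.image fun Q => Q 3)
    (by
      intro q hq
      obtain ⟨Q, hQ, rfl⟩ := Finset.mem_image.1 hq
      exact hne Q hQ 3 (by decide))
    (by
      intro q hq q' hq'
      obtain ⟨Q, hQ, rfl⟩ := Finset.mem_image.1 hq
      obtain ⟨Q', hQ', rfl⟩ := Finset.mem_image.1 hq'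
      exact h3 Q hQ Q' hQ')
  have hinj : Set.InjOn (fun Q : Quad => (Q 1, Q 3)) G := by
    intro Q hQ Q' hQ' h
    obtain ⟨e1, e3⟩ := Prod.mk.inj h
    have e0 : Q 0 = Q' 0 := (hp Q hQ).trans (hp Q' hQ').symm
    have e2 : Q 2 = Q' 2 := by
      have p1 : Q 0 + Q 2 = Q 1 + Q 3 := (hG Q hQ).1.1
      have p2 : Q' 0 + Q' 2 = Q' 1 + Q' 3 := (hG Q' hQ').1.1
      rw [← e0, ← e1, ← e3, ← p1] at p2
      exact (add_left_cancel p2).symm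
    funext k
    fin_cases k
    exacts [e0, e1, e2, e3]
  calc ∑ Q ∈ G, 1 / (gcdP (Q 0 - Q 3) : ℝ)
      = ∑ x ∈ G.image (fun Q : Quad => (Q 1, Q 3)), 1 / (gcdP (p - x.2) : ℝ) := by
        rw [Finset.sum_image hinj]
        exact Finset.sum_congr rfl fun Q hQ => by rw [hp Q hQ]
    _ ≤ ∑ x ∈ (G.image fun Q => Q 1) ×ˢ (G.image fun Q => Q 3), 1 / (gcdP (p - x.2) : ℝ) := by
        refine Finset.sum_le_sum_of_subset_of_nonneg (fun x hx => ?_)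
          (fun _ _ _ => by positivity)
        obtain ⟨Q, hQ, rfl⟩ := Finset.mem_image.1 hx
        exact Finset.mem_product.2 ⟨Finset.mem_image_of_mem (fun Q : Quad => Q 1) hQ,
          Finset.mem_image_of_mem (fun Q : Quad => Q 3) hQ⟩
    _ = ((G.image fun Q => Q 1).card : ℝ) *
          ∑ q ∈ G.image (fun Q => Q 3), 1 / (gcdP (p - q) : ℝ) := by
        simp only [Finset.sum_product, Finset.sum_const, nsmul_eq_mul]
    _ ≤ 2 ^ (a 1 + 1) * (2 * √(2 ^ (a 3 + 1))) := by
        refine mul_le_mul (by exact_mod_cast hc1) (hgcd.trans ?_)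
          (Finset.sum_nonneg fun _ _ => by positivity) (by positivity)
        refine mul_le_mul_of_nonneg_left (Real.sqrt_le_sqrt ?_) (by norm_num)
        exact_mod_cast hc3

/-- The contribution of the rectangles for which the line through `Q 0` and its neighbour `Q e`
contains at least `2 ^ a 0` points of `S (j 0)`. -/
lemma sum_inv_gcdP_le_of_rich_side {S : ℕ → Finset Pt} {j a : Fin 4 → ℕ} {C : ℕ}
    (hS : (S (j 0)).card ≤ 2 ^ j 0) (ha : 1 ≤ a 0) (haC : 2 * a 0 ≤ j 0 + 2 * C)
    (e : Fin 4) (he : e = 1 ∨ e = 3) (F : Finset Quad) (hF : ∀ Q ∈ F, Q ∈ QZeroJA S j a)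
    (hrich : ∀ Q ∈ F, 2 ^ a 0 ≤ lineCount (lineThrough (Q 0) (Q e)) (S (j 0))) :
    ∑ Q ∈ F, 1 / (gcdP (Q 0 - Q 3) : ℝ) ≤
      (12 * 4 ^ C + 2304) * (2 ^ j 0) ^ 2 / (2 ^ a 0) ^ 2 *
        (2 ^ (a 1 + 1) * (2 * √(2 ^ (a 3 + 1)))) := by
  classical
  have he0 : e ≠ 0 := by rcases he with rfl | rfl <;> decide
  have hne : ∀ Q ∈ F, Q 0 ≠ Q e := fun Q hQ h => he0 ((hF Q hQ).2.1 h).symm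
  set key : Quad → (ℝ × ℝ) × Pt := fun Q => (slopeIntercept (Q 0) (Q e), Q 0) with hkey
  have hI := card_rich_incidences_mul_sq_le (S (j 0)) (k := 2 ^ a 0)
    (by simpa using Nat.pow_le_pow_right (n := 2) (by norm_num) ha) (F.image key) (by
      intro x hx
      obtain ⟨Q, hQ, rfl⟩ := Finset.mem_image.1 hx
      have h := hrich Q hQ
      rw [lineCount_lineThrough (hne Q hQ)] at h
      simp only [hkey, mem_slopeIntercept_iff (hne Q hQ)]
      refine ⟨(hF Q hQ).2.2.1 0, ?_, h⟩
      simp [collinDet])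
  have hI' : (F.image key).card * (2 ^ a 0) ^ 2 ≤ (12 * 4 ^ C + 2304) * (2 ^ j 0) ^ 2 := by
    have h1 : (2 ^ a 0) ^ 2 ≤ 2 ^ j 0 * 4 ^ C := by
      have h4 : 4 ^ C = 2 ^ (2 * C) := by norm_num [pow_mul]
      rw [h4, ← pow_mul, ← pow_add]
      exact Nat.pow_le_pow_right (by norm_num) (by omega)
    have h2 : 12 * (S (j 0)).card * (2 ^ a 0) ^ 2 ≤ 12 * 2 ^ j 0 * (2 ^ j 0 * 4 ^ C) :=
      Nat.mul_le_mul (Nat.mul_le_mul_left _ hS) h1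
    have h3 : 2304 * (S (j 0)).card ^ 2 ≤ 2304 * (2 ^ j 0) ^ 2 :=
      Nat.mul_le_mul_left _ (Nat.pow_le_pow_left hS 2)
    calc _ ≤ _ := hI
      _ ≤ _ := Nat.add_le_add h2 h3
      _ = _ := by ring
  have hfib : ∀ x ∈ F.image key, ∑ Q ∈ F with key Q = x, 1 / (gcdP (Q 0 - Q 3) : ℝ) ≤
      2 ^ (a 1 + 1) * (2 * √(2 ^ (a 3 + 1))) := by
    intro x _
    have hmem : ∀ Q ∈ F.filter (fun Q => key Q = x), Q ∈ F ∧ Q 0 = x.2 ∧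
        slopeIntercept x.2 (Q e) = x.1 := by
      intro Q hQ
      obtain ⟨hQF, rfl⟩ := Finset.mem_filter.1 hQ
      exact ⟨hQF, rfl, rfl⟩
    have hcol : ∀ Q ∈ F.filter (fun Q => key Q = x), ∀ Q' ∈ F.filter (fun Q => key Q = x),
        collinDet x.2 (Q e) (Q' e) = 0 := by
      intro Q hQ Q' hQ'
      obtain ⟨h1, h2, h3⟩ := hmem Q hQ
      obtain ⟨h1', h2', h3'⟩ := hmem Q' hQ'
      exact collinDet_eq_zero_of_slopeIntercept_eq (h2 ▸ hne Q h1) (h2' ▸ hne Q' h1')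
        (h3.trans h3'.symm)
    have hiff : ∀ Q ∈ F.filter (fun Q => key Q = x), ∀ Q' ∈ F.filter (fun Q => key Q = x),
        (collinDet x.2 (Q 1) (Q' 1) = 0 ↔ collinDet x.2 (Q 3) (Q' 3) = 0) := by
      intro Q hQ Q' hQ'
      obtain ⟨h1, h2, -⟩ := hmem Q hQ
      obtain ⟨h1', h2', -⟩ := hmem Q' hQ'
      have h := collinDet_one_eq_zero_iff_three (hF Q h1).1 (hF Q' h1').1 (hF Q h1).2.1
        (hF Q' h1').2.1 (h2.trans h2'.symm)
      rwa [h2] at h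
    refine sum_inv_gcdP_le_of_common_cross x.2 _ (fun Q hQ => hF Q (hmem Q hQ).1)
      (fun Q hQ => (hmem Q hQ).2.1) (fun Q hQ Q' hQ' => ?_) (fun Q hQ Q' hQ' => ?_)
    · rcases he with rfl | rfl
      · exact hcol Q hQ Q' hQ'
      · exact (hiff Q hQ Q' hQ').2 (hcol Q hQ Q' hQ')
    · rcases he with rfl | rfl
      · exact (hiff Q hQ Q' hQ').1 (hcol Q hQ Q' hQ')
      · exact hcol Q hQ Q' hQ'
  rw [← Finset.sum_fiberwise_of_maps_to (fun Q hQ => Finset.mem_image_of_mem key hQ)]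
  refine (Finset.sum_le_card_nsmul _ _ _ hfib).trans ?_
  rw [nsmul_eq_mul]
  refine mul_le_mul_of_nonneg_right ?_ (by positivity)
  rw [le_div_iff₀ (by positivity)]
  exact_mod_cast hI'

/-- **Estimate (3.11) of Lemma 3.5.** If `1 ≤ a₁ < j₁/2 + C` then
`Σ_{Q ∈ 𝒬⁰(j⃗,a⃗)} 1/gcd(ξ₁−ξ₄) ≲ 2^{2j₁ − 2a₁ + a₂ + a₄/2}`. -/
theorem QZeroJA_gcd_sum (C : ℕ) :
    ∃ c : ℝ, 0 < c ∧
      ∀ (m : ℕ) (S : ℕ → Finset Pt),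
        1 ≤ m →
        (∀ i ≤ m, ∀ j ≤ m, i ≠ j → Disjoint (S i) (S j)) →
        (∀ j ≤ m, (S j).card ≤ 2 ^ j) →
        ∀ j a : Fin 4 → ℕ, (∀ k, j k ≤ m) →
          1 ≤ a 0 → (a 0 : ℝ) < (j 0 : ℝ) / 2 + (C : ℝ) →
          ∑' Q : Quad, Set.indicator (QZeroJA S j a)
              (fun Q => 1 / (gcdP (Q 0 - Q 3) : ℝ)) Q ≤
            c * (2 : ℝ) ^ (2 * (j 0 : ℝ) - 2 * (a 0 : ℝ) + (a 1 : ℝ) + (a 3 : ℝ) / 2) := by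
  classical
  refine ⟨16 * (12 * 4 ^ C + 2304), by positivity, ?_⟩
  intro m S _ _ hS j a hj ha haC
  have haC' : 2 * a 0 ≤ j 0 + 2 * C := by
    have : 2 * (a 0 : ℝ) < j 0 + 2 * C := by linarith
    exact_mod_cast this.le
  set F := (Fintype.piFinset fun k => S (j k)).filter (· ∈ QZeroJA S j a) with hF
  have hFmem : ∀ Q, Q ∈ F ↔ Q ∈ QZeroJA S j a := fun Q => by
    rw [hF, Finset.mem_filter, Fintype.mem_piFinset]
    exact ⟨And.right, fun h => ⟨h.2.2.1, h⟩⟩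
  rw [tsum_eq_sum (s := F) fun Q hQ => Set.indicator_of_notMem (mt (hFmem Q).2 hQ) _,
    Finset.sum_congr rfl fun Q hQ => Set.indicator_of_mem ((hFmem Q).1 hQ) _]
  set B : ℝ := (12 * 4 ^ C + 2304) * (2 ^ j 0) ^ 2 / (2 ^ a 0) ^ 2 *
    (2 ^ (a 1 + 1) * (2 * √(2 ^ (a 3 + 1)))) with hB
  have hside : ∀ e : Fin 4, e = 1 ∨ e = 3 →
      ∑ Q ∈ F with 2 ^ a 0 ≤ lineCount (lineThrough (Q 0) (Q e)) (S (j 0)),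
        1 / (gcdP (Q 0 - Q 3) : ℝ) ≤ B := fun e he =>
    sum_inv_gcdP_le_of_rich_side (hS _ (hj 0)) ha haC' e he _
      (fun Q hQ => (hFmem Q).1 (Finset.mem_filter.1 hQ).1) (fun Q hQ => (Finset.mem_filter.1 hQ).2)
  have hsum : ∑ Q ∈ F, 1 / (gcdP (Q 0 - Q 3) : ℝ) ≤ B + B := by
    refine le_trans ?_ (add_le_add (hside 1 (Or.inl rfl)) (hside 3 (Or.inr rfl)))
    rw [← Finset.sum_union_inter]
    refine le_add_of_le_of_nonneg (Finset.sum_le_sum_of_subset_of_nonneg (fun Q hQ => ?_)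
      (fun _ _ _ => by positivity)) (Finset.sum_nonneg fun _ _ => by positivity)
    have h := (((hFmem Q).1 hQ).2.2.2 0).1
    rw [le_max_iff] at h
    exact Finset.mem_union.2 (h.imp (fun h => Finset.mem_filter.2 ⟨hQ, h⟩)
      (fun h => Finset.mem_filter.2 ⟨hQ, h⟩))
  have hpow : (2 : ℝ) ^ (2 * (j 0 : ℝ) - 2 * (a 0 : ℝ) + (a 1 : ℝ) + (a 3 : ℝ) / 2) =
      (2 ^ j 0) ^ 2 / (2 ^ a 0) ^ 2 * 2 ^ a 1 * √(2 ^ a 3) := by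
    rw [Real.rpow_add two_pos, Real.rpow_add two_pos, Real.rpow_sub two_pos, Real.sqrt_eq_rpow,
      ← Real.rpow_natCast 2 (a 1), ← Real.rpow_natCast 2 (a 3), ← Real.rpow_mul two_pos.le,
      ← pow_mul, ← pow_mul, ← Real.rpow_natCast, ← Real.rpow_natCast]
    push_cast
    ring_nf
  have hsqrt : √((2 : ℝ) ^ (a 3 + 1)) ≤ 2 * √(2 ^ a 3) := by
    rw [pow_succ, mul_comm, Real.sqrt_mul two_pos.le]
    refine mul_le_mul_of_nonneg_right ?_ (Real.sqrt_nonneg _)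
    exact Real.sqrt_le_iff.2 ⟨two_pos.le, by norm_num⟩
  refine hsum.trans ?_
  rw [hpow]
  calc B + B = 2 * ((12 * 4 ^ C + 2304) * (2 ^ j 0) ^ 2 / (2 ^ a 0) ^ 2 *
        (2 ^ (a 1 + 1) * (2 * √(2 ^ (a 3 + 1))))) := by rw [hB]; ring
    _ ≤ 2 * ((12 * 4 ^ C + 2304) * (2 ^ j 0) ^ 2 / (2 ^ a 0) ^ 2 *
        (2 ^ (a 1 + 1) * (2 * (2 * √(2 ^ a 3))))) := by gcongr
    _ = _ := by ring
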